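/- Suppose a finite legal sequence of Engel moves starts and ends at the same configuration on the transient states, with v ≥ 1 type-2 moves (all at the distinguished transient state u). Let w_j = r_j × (number of type-1 moves at transient state j) and v_k the number of chips deposited into absorbing state k during the run. Let Q be the r×r matrix with Q_{ij} = r_{ij}/rᵢ for transient i, j, and R the r×(s−r) matrix with R_{ik} = r_{ik}/rᵢ for transient i and absorbing k. Then for every transient state j, w_j / v = ((I − Q)⁻¹)_{u,j}, and for every absorbing state k, v_k / v = ((I − Q)⁻¹ R)_{u,k}. -/

import Mathlib

/-- A move in Engel's chip game: a type-1 move fires the transient state `i`,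
a type-2 move adds a single chip at the distinguished starting state. -/
inductive EngelMove (s : ℕ) where
  | type1 (i : Fin s) : EngelMove s
  | type2 : EngelMove s
deriving DecidableEq

/-- The effect of a move on a configuration of chips: a type-1 move at `i` removes
`ri i` chips from `i` and sends `rij i j` chips to each state `j`; a type-2 move adds
one chip at the distinguished state `u`. -/
def engelApply {s : ℕ} (u : Fin s) (ri : Fin s → ℕ) (rij : Fin s → Fin s → ℕ) :
    EngelMove s → (Fin s → ℕ) → (Fin s → ℕ)
  | .type1 i, c => fun j => c j - (if j = i then ri i else 0) + rij i j
  | .type2, c => fun j => c j + (if j = u then 1 else 0)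

/-- Legality of a move in a configuration (`r` = number of transient states):
a type-1 move at `i` is legal iff `i` is transient and carries at least `ri i` chips;
type-2 moves are always allowed. -/
def engelLegal {s : ℕ} (r : ℕ) (ri : Fin s → ℕ) :
    EngelMove s → (Fin s → ℕ) → Prop
  | .type1 i, c => (i : ℕ) < r ∧ ri i ≤ c i
  | .type2, _ => True

/-- A list of moves is a legal sequence from a configuration if every type-1 move in it
is legal in the configuration at which it is performed. -/
def engelLegalSeq {s : ℕ} (r : ℕ) (u : Fin s) (ri : Fin s → ℕ)
    (rij : Fin s → Fin s → ℕ) : (Fin s → ℕ) → List (EngelMove s) → Prop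
  | _, [] => True
  | c, m :: ms => engelLegal r ri m c ∧
      engelLegalSeq r u ri rij (engelApply u ri rij m c) ms

/-- The configuration obtained after performing a list of moves. -/
def engelRun {s : ℕ} (u : Fin s) (ri : Fin s → ℕ) (rij : Fin s → Fin s → ℕ)
    (c : Fin s → ℕ) (ms : List (EngelMove s)) : Fin s → ℕ :=
  ms.foldl (fun c m => engelApply u ri rij m c) c

/-- Chip balance at a state `j`: final chips plus chips fired from `j` equal initial chips
plus chips added at `j` plus chips received from fired states. -/
theorem engelRun_add_fired {s : ℕ} (r : ℕ) (u : Fin s) (ri : Fin s → ℕ)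
    (rij : Fin s → Fin s → ℕ) (ms : List (EngelMove s)) (c : Fin s → ℕ)
    (h : engelLegalSeq r u ri rij c ms) (j : Fin s) :
    engelRun u ri rij c ms j + ri j * ms.count (EngelMove.type1 j) =
      c j + (if j = u then ms.count EngelMove.type2 else 0) +
        ∑ i, ms.count (EngelMove.type1 i) * rij i j := by
  induction ms generalizing c with
  | nil => simp [engelRun]
  | cons m ms ih =>
    obtain ⟨hm, hms⟩ := h
    have hrun : engelRun u ri rij c (m :: ms) =
        engelRun u ri rij (engelApply u ri rij m c) ms := rfl
    have key := ih _ hms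
    rw [hrun]
    cases m with
    | type1 i =>
      have hc : ∀ a, (EngelMove.type1 i :: ms).count (EngelMove.type1 a) =
          ms.count (EngelMove.type1 a) + if a = i then 1 else 0 := fun a => by
        rw [List.count_cons]
        by_cases hai : a = i
        · simp [hai]
        · simp [hai, Ne.symm hai]
      have h2 : (EngelMove.type1 i :: ms).count EngelMove.type2 =
          ms.count EngelMove.type2 := by simp
      simp only [hc, h2, add_mul, Finset.sum_add_distrib, ite_mul, one_mul, zero_mul,
        Finset.sum_ite_eq', Finset.mem_univ, if_true, mul_add]
      have hle : ri i ≤ c i := hm.2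
      simp only [engelApply] at key ⊢
      by_cases hji : j = i
      · subst hji
        simp only [if_true] at key ⊢
        omega
      · simp only [hji, if_false] at key ⊢
        omega
    | type2 =>
      have hc : ∀ a, (EngelMove.type2 :: ms).count (EngelMove.type1 a) =
          ms.count (EngelMove.type1 a) := fun a => by simp
      have h2 : (EngelMove.type2 :: ms).count EngelMove.type2 =
          ms.count EngelMove.type2 + 1 := by simp
      simp only [hc, h2]
      simp only [engelApply] at key ⊢
      split_ifs at key ⊢ <;> omega

/-- Absorbing states are never fired in a legal sequence. -/
theorem count_type1_eq_zero_of_absorbing {s : ℕ} (r : ℕ) (u : Fin s) (ri : Fin s → ℕ)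
    (rij : Fin s → Fin s → ℕ) (ms : List (EngelMove s)) (c : Fin s → ℕ)
    (h : engelLegalSeq r u ri rij c ms) (j : Fin s) (hj : r ≤ (j : ℕ)) :
    ms.count (EngelMove.type1 j) = 0 := by
  induction ms generalizing c with
  | nil => simp
  | cons m ms ih =>
    obtain ⟨hm, hms⟩ := h
    rw [List.count_cons, ih _ hms]
    cases m with
    | type1 i =>
      have hi : (i : ℕ) < r := hm.1
      have : i ≠ j := by rintro rfl; omega
      simp [this]
    | type2 => simp

/-- Maximum principle: a function that is harmonic on the transient states and vanishes on
the absorbing states is nonpositive. -/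
theorem nonpos_of_harmonic {r s : ℕ} (ri : Fin s → ℕ) (rij : Fin s → Fin s → ℕ)
    (hsum : ∀ i : Fin s, (i : ℕ) < r → ∑ j, rij i j = ri i)
    (habsorbing : ∀ i : Fin s, (i : ℕ) < r →
      ∃ (m : ℕ) (f : ℕ → Fin s), f 0 = i ∧ (∀ k < m, 0 < rij (f k) (f (k + 1))) ∧
        r ≤ ((f m : Fin s) : ℕ))
    (y : Fin s → ℚ) (hy0 : ∀ j : Fin s, r ≤ (j : ℕ) → y j = 0)
    (hy : ∀ i : Fin s, (i : ℕ) < r → (ri i : ℚ) * y i = ∑ j, (rij i j : ℚ) * y j)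
    (i : Fin s) : y i ≤ 0 := by
  have : Nonempty (Fin s) := ⟨i⟩
  obtain ⟨a, ha⟩ := Finite.exists_max y
  refine (ha i).trans ?_
  by_contra! hpos
  have htrans : ∀ b, y b = y a → (b : ℕ) < r := fun b hb => by
    by_contra! hbr
    rw [← hb, hy0 b hbr] at hpos
    exact lt_irrefl _ hpos
  obtain ⟨m, f, hf0, hf, hfm⟩ := habsorbing a (htrans a rfl)
  have hpath : ∀ k ≤ m, y (f k) = y a := by
    intro k
    induction k with
    | zero => intro _; rw [hf0]
    | succ k ih =>
      intro hk
      have hk' := ih (by omega)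
      have hb := htrans _ hk'
      have hzero : ∑ j, (rij (f k) j : ℚ) * (y a - y j) = 0 := by
        simp only [mul_sub, Finset.sum_sub_distrib]
        rw [← hy _ hb, ← Finset.sum_mul, ← hsum _ hb, hk']
        push_cast
        ring
      have hterm := (Finset.sum_eq_zero_iff_of_nonneg (fun j _ =>
        mul_nonneg (Nat.cast_nonneg _) (sub_nonneg.2 (ha j)))).1 hzero (f (k + 1))
          (Finset.mem_univ _)
      have hne : (rij (f k) (f (k + 1)) : ℚ) ≠ 0 := by
        exact_mod_cast (hf k (by omega)).ne'
      rcases mul_eq_zero.1 hterm with h | h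
      · exact absurd h hne
      · linarith
  have := htrans _ (hpath m le_rfl)
  omega

/-- A sum over all states of a function vanishing on the absorbing states is a sum over the
transient states. -/
theorem sum_castLE_eq_sum {r s : ℕ} (hrs : r ≤ s) (g : Fin s → ℚ)
    (hg : ∀ j : Fin s, r ≤ (j : ℕ) → g j = 0) :
    ∑ i : Fin r, g (Fin.castLE hrs i) = ∑ j, g j := by
  refine Fintype.sum_of_injective (Fin.castLE hrs) (Fin.castLE_injective hrs) _ _ ?_
    fun _ => rfl
  intro j hj
  refine hg j ?_
  by_contra! h
  exact hj ⟨⟨j, h⟩, rfl⟩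

/-- The fundamental matrix of an absorbing chain exists. -/
theorem isUnit_one_sub_of_absorbing {r s : ℕ} (hrs : r ≤ s)
    (ri : Fin s → ℕ) (hri : ∀ i : Fin s, (i : ℕ) < r → 0 < ri i)
    (rij : Fin s → Fin s → ℕ)
    (hsum : ∀ i : Fin s, (i : ℕ) < r → ∑ j, rij i j = ri i)
    (habsorbing : ∀ i : Fin s, (i : ℕ) < r →
      ∃ (m : ℕ) (f : ℕ → Fin s), f 0 = i ∧ (∀ k < m, 0 < rij (f k) (f (k + 1))) ∧
        r ≤ ((f m : Fin s) : ℕ))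
    (Q : Matrix (Fin r) (Fin r) ℚ)
    (hQ : ∀ i j : Fin r, Q i j =
      (rij (Fin.castLE hrs i) (Fin.castLE hrs j) : ℚ) / (ri (Fin.castLE hrs i) : ℚ)) :
    IsUnit (1 - Q) := by
  rw [← Matrix.mulVec_injective_iff_isUnit]
  refine (injective_iff_map_eq_zero (Matrix.mulVecLin (1 - Q))).2 fun x hx => ?_
  rw [Matrix.mulVecLin_apply, Matrix.sub_mulVec, Matrix.one_mulVec, sub_eq_zero] at hx
  let y : Fin s → ℚ := fun j => if h : (j : ℕ) < r then x ⟨j, h⟩ else 0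
  have hy0 : ∀ j : Fin s, r ≤ (j : ℕ) → y j = 0 := fun j hj => by
    simp [y, Nat.not_lt.2 hj]
  have hyx : ∀ i : Fin r, y (Fin.castLE hrs i) = x i := fun i => by simp [y]
  have hy : ∀ i : Fin s, (i : ℕ) < r →
      (ri i : ℚ) * y i = ∑ j, (rij i j : ℚ) * y j := fun i hi => by
    have hne : (ri i : ℚ) ≠ 0 := by exact_mod_cast (hri i hi).ne'
    rw [← sum_castLE_eq_sum hrs _ fun j hj => by rw [hy0 j hj, mul_zero]]
    have hyi : y i = x ⟨i, hi⟩ := hyx ⟨i, hi⟩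
    rw [hyi, congrFun hx ⟨i, hi⟩, Matrix.mulVec, dotProduct, Finset.mul_sum]
    refine Finset.sum_congr rfl fun j _ => ?_
    have hcast : Fin.castLE hrs ⟨i, hi⟩ = i := rfl
    rw [hQ, hyx, hcast]
    field_simp
  funext i
  have hle := nonpos_of_harmonic ri rij hsum habsorbing y hy0 hy (Fin.castLE hrs i)
  have hge := nonpos_of_harmonic ri rij hsum habsorbing (fun j => -y j)
    (fun j hj => by simp [hy0 j hj])
    (fun i hi => by simp [hy i hi]) (Fin.castLE hrs i)
  simp only [hyx] at hle hge
  exact le_antisymm hle (neg_nonpos.1 hge)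

/-- If a finite legal sequence of Engel moves starts and ends at the
same configuration on the transient states, with `v ≥ 1` type-2 moves, then with
`w j = rⱼ · (number of type-1 moves at j)` and `v k` the number of chips deposited into
absorbing state `k`, and with `Q`, `R` the matrices of transition probabilities
`r_{ij}/rᵢ`, we have `w j / v = N_{u j}` where `N = (I - Q)⁻¹`, and
`v k / v = (N R)_{u k}`. -/
theorem engel_algorithm_computes_N_and_B
    (r s : ℕ) (hr : 1 ≤ r) (hrs : r < s)
    (u : Fin s) (hu : (u : ℕ) < r)
    (ri : Fin s → ℕ) (hri : ∀ i : Fin s, (i : ℕ) < r → 0 < ri i)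
    (rij : Fin s → Fin s → ℕ)
    (hsum : ∀ i : Fin s, (i : ℕ) < r → ∑ j, rij i j = ri i)
    (habsorbing : ∀ i : Fin s, (i : ℕ) < r →
      ∃ (m : ℕ) (f : ℕ → Fin s), f 0 = i ∧ (∀ k < m, 0 < rij (f k) (f (k + 1))) ∧
        r ≤ ((f m : Fin s) : ℕ))
    (c : Fin s → ℕ) (ms : List (EngelMove s))
    (hlegal : engelLegalSeq r u ri rij c ms)
    (hsame : ∀ i : Fin s, (i : ℕ) < r → engelRun u ri rij c ms i = c i)
    (hv1 : 1 ≤ ms.count EngelMove.type2)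
    (v : ℚ) (hv : v = (ms.count EngelMove.type2 : ℚ))
    (w : Fin s → ℚ)
    (hw : ∀ j : Fin s, w j = (ri j : ℚ) * (ms.count (EngelMove.type1 j) : ℚ))
    (vk : Fin s → ℚ)
    (hvk : ∀ k : Fin s, vk k = ∑ j ∈ Finset.univ.filter (fun j : Fin s => (j : ℕ) < r),
      (ms.count (EngelMove.type1 j) : ℚ) * (rij j k : ℚ))
    (Q : Matrix (Fin r) (Fin r) ℚ)
    (hQ : ∀ i j : Fin r, Q i j =
      (rij (Fin.castLE hrs.le i) (Fin.castLE hrs.le j) : ℚ) / (ri (Fin.castLE hrs.le i) : ℚ))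
    (R : Matrix (Fin r) {k : Fin s // r ≤ (k : ℕ)} ℚ)
    (hR : ∀ (i : Fin r) (k : {k : Fin s // r ≤ (k : ℕ)}),
      R i k = (rij (Fin.castLE hrs.le i) k.1 : ℚ) / (ri (Fin.castLE hrs.le i) : ℚ)) :
    (∀ j : Fin r, w (Fin.castLE hrs.le j) / v = (1 - Q)⁻¹ ⟨(u : ℕ), hu⟩ j) ∧
    (∀ k : {k : Fin s // r ≤ (k : ℕ)},
      vk k.1 / v = ((1 - Q)⁻¹ * R) ⟨(u : ℕ), hu⟩ k) := by
  have hunit := isUnit_one_sub_of_absorbing hrs.le ri hri rij hsum habsorbing Q hQ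
  have hdet : IsUnit (1 - Q).det := (Matrix.isUnit_iff_isUnit_det _).1 hunit
  have hv0 : v ≠ 0 := by
    rw [hv]
    exact_mod_cast (by omega : ms.count EngelMove.type2 ≠ 0)
  have hcount := count_type1_eq_zero_of_absorbing r u ri rij ms c hlegal
  let W : Fin r → ℚ := fun j => w (Fin.castLE hrs.le j) / v
  have hfire : ∀ (i : Fin r) (j : Fin s), W i *
      ((rij (Fin.castLE hrs.le i) j : ℚ) / (ri (Fin.castLE hrs.le i) : ℚ)) =
      (ms.count (EngelMove.type1 (Fin.castLE hrs.le i)) : ℚ) *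
        (rij (Fin.castLE hrs.le i) j : ℚ) / v := fun i j => by
    have hne : (ri (Fin.castLE hrs.le i) : ℚ) ≠ 0 := by
      exact_mod_cast (hri _ i.2).ne'
    simp only [W, hw]
    field_simp
  have hsumfire : ∀ j : Fin s, ∑ i : Fin r, W i *
      ((rij (Fin.castLE hrs.le i) j : ℚ) / (ri (Fin.castLE hrs.le i) : ℚ)) =
      (∑ i, (ms.count (EngelMove.type1 i) : ℚ) * (rij i j : ℚ)) / v := fun j => by
    simp only [hfire]
    rw [← Finset.sum_div, sum_castLE_eq_sum hrs.le
      (fun i => (ms.count (EngelMove.type1 i) : ℚ) * (rij i j : ℚ))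
      fun i hi => by simp [hcount i hi]]
  have hbalance : Matrix.vecMul W (1 - Q) = Pi.single ⟨(u : ℕ), hu⟩ 1 := by
    funext j
    have hb := engelRun_add_fired r u ri rij ms c hlegal (Fin.castLE hrs.le j)
    rw [hsame _ j.2, add_assoc, Nat.add_left_cancel_iff] at hb
    have hbq : w (Fin.castLE hrs.le j) = (if Fin.castLE hrs.le j = u then v else 0) +
        ∑ i, (ms.count (EngelMove.type1 i) : ℚ) * (rij i (Fin.castLE hrs.le j) : ℚ) := by
      rw [hw, hv]
      exact_mod_cast hb
    have hiff : Fin.castLE hrs.le j = u ↔ j = ⟨(u : ℕ), hu⟩ := by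
      simp [Fin.ext_iff]
    rw [Matrix.vecMul_sub, Matrix.vecMul_one, Pi.sub_apply, Matrix.vecMul, dotProduct]
    simp only [hQ]
    rw [hsumfire, Pi.single_apply]
    simp only [W, hbq, hiff]
    split_ifs <;> field_simp <;> ring
  have hW : W = (1 - Q)⁻¹ ⟨(u : ℕ), hu⟩ := by
    have h := congrArg (fun x => Matrix.vecMul x (1 - Q)⁻¹) hbalance
    simpa [Matrix.vecMul_vecMul, Matrix.mul_nonsing_inv _ hdet, Matrix.row] using h
  refine ⟨fun j => congrFun hW j, fun k => ?_⟩
  rw [Matrix.mul_apply, ← hW]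
  simp only [hR]
  rw [hsumfire, hvk, Finset.sum_filter]
  congr 1
  refine Finset.sum_congr rfl fun i _ => ?_
  split_ifs with hi
  · rfl
  · simp [hcount i (not_lt.1 hi)]
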